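/- For any word u of length n ≥ 1, the sum σ(u) of the exponents of all runs in u satisfies σ(u) < 3·ρ(u) + n, where ρ(u) is the number of runs in u. -/

import Mathlib

open scoped Classical

namespace RunsExp

variable {α : Type*}

/-- `p` is a period of the word `w`. -/
def IsPeriod (w : List α) (p : ℕ) : Prop :=
  0 < p ∧ ∀ i : ℕ, i + p < w.length → w[i]? = w[i + p]?

/-- The shortest period of the word `w`. -/
noncomputable def minPeriod (w : List α) : ℕ := sInf {p | IsPeriod w p}

/-- The factor `u[i..j]` of `u` (0-based indices, inclusive on both ends). -/
def factor (u : List α) (i j : ℕ) : List α := (u.drop i).take (j - i + 1)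

/-- `[i..j]` is a run in `u` (0-based indices): the shortest period `p` of `u[i..j]`
satisfies `2p ≤ j-i+1` and the interval can be extended neither to the left nor to
the right without violating this property. -/
def IsRun (u : List α) (i j : ℕ) : Prop :=
  i ≤ j ∧ j < u.length ∧
  2 * minPeriod (factor u i j) ≤ j - i + 1 ∧
  (i = 0 ∨ u[i - 1]? ≠ u[i + minPeriod (factor u i j) - 1]?) ∧
  (j = u.length - 1 ∨ u[j - minPeriod (factor u i j) + 1]? ≠ u[j + 1]?)

/-- The exponent of the run `[i..j]` of `u`. -/
noncomputable def exponent (u : List α) (i j : ℕ) : ℚ :=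
  ((j : ℚ) - (i : ℚ) + 1) / (minPeriod (factor u i j) : ℚ)

/-- The set of all runs of `u`, as a finset of pairs of indices. -/
noncomputable def runs (u : List α) : Finset (ℕ × ℕ) :=
  (Finset.range u.length ×ˢ Finset.range u.length).filter fun q => IsRun u q.1 q.2

/-- The sum of exponents of all runs in `u`. -/
noncomputable def sigma (u : List α) : ℚ :=
  ∑ q ∈ runs u, exponent u q.1 q.2

/-- The lexicographically minimal word cyclically equivalent to `w`. -/
noncomputable def minRot [LinearOrder α] (w : List α) : List α :=
  ((List.range w.length).map w.rotate).foldr min w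

/-- The lexicographically maximal word cyclically equivalent to `w`. -/
noncomputable def maxRot [LinearOrder α] (w : List α) : List α :=
  ((List.range w.length).map w.rotate).foldr max w

/-- The word `x` occurs in `u` at (0-based) starting position `s`, entirely within
the interval `[i..j]`. -/
def OccursAt (u : List α) (i j : ℕ) (x : List α) (s : ℕ) : Prop :=
  i ≤ s ∧ s + x.length ≤ j + 1 ∧ factor u s (s + x.length - 1) = x

/-- `s` and `s'` are starting positions of consecutive occurrences of `x`
inside the interval `[i..j]` of `u`. -/
def ConsecutiveOcc (u : List α) (i j : ℕ) (x : List α) (s s' : ℕ) : Prop :=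
  OccursAt u i j x s ∧ OccursAt u i j x s' ∧ s < s' ∧
    ∀ t, s < t → t < s' → ¬ OccursAt u i j x t

/-- The set of handles of the run `[i..j]` of `u`: inter-position `k` lies between
the letters at positions `k` and `k+1`.  If the minimal and maximal rotations of the
period-prefix `w` coincide, all inter-positions inside the run are handles; otherwise
the handles are the inter-positions between consecutive occurrences of the minimal
rotation and between consecutive occurrences of the maximal rotation. -/
noncomputable def handles [LinearOrder α] (u : List α) (i j : ℕ) : Set ℕ :=
  let p := minPeriod (factor u i j)
  let w := factor u i (i + p - 1)
  if minRot w = maxRot w then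
    {k | i ≤ k ∧ k < j}
  else
    {k | ∃ s s', (ConsecutiveOcc u i j (minRot w) s s' ∨
                  ConsecutiveOcc u i j (maxRot w) s s') ∧ k = s' - 1}

/-- `[i..j]` is a cubic run in `u`. -/
def IsCubicRun (u : List α) (i j : ℕ) : Prop :=
  IsRun u i j ∧ 3 * minPeriod (factor u i j) ≤ j - i + 1

/-- The set of all cubic runs of `u`. -/
noncomputable def cubicRuns (u : List α) : Finset (ℕ × ℕ) :=
  (Finset.range u.length ×ˢ Finset.range u.length).filter fun q => IsCubicRun u q.1 q.2

/-- The sum of exponents of all cubic runs in `u`. -/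
noncomputable def sigmaCubic (u : List α) : ℚ :=
  ∑ q ∈ cubicRuns u, exponent u q.1 q.2



theorem lex_drop {β : Type*} [LinearOrder β] (a b : ℕ → β) (m : ℕ)
    (hag : ∀ k, k < m → a k = b k) (h : toLex a ≤ toLex b) :
    toLex (fun k => a (m + k)) ≤ toLex (fun k => b (m + k)) := by
  by_contra hlt
  rw [not_le] at hlt
  obtain ⟨k, h1, h2⟩ := hlt
  have : toLex b < toLex a := by
    refine ⟨m + k, ?_, ?_⟩
    · intro l hl
      rcases lt_or_ge l m with hm | hm
      · exact (hag l hm).symm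
      · have := h1 (l - m) (by omega)
        simp only [Pi.toLex_apply] at this ⊢
        rwa [Nat.add_sub_cancel' hm] at this
    · exact h2
  exact absurd h (not_le.mpr this)

theorem exists_unbordered {β : Type*} [LinearOrder β] (g : ℕ → β) (p : ℕ) (hp : 0 < p)
    (hper : ∀ k, g (k + p) = g k)
    (hmin : ∀ q, 0 < q → q < p → ∃ k, g (k + q) ≠ g k) :
    ∃ c, c < p ∧ ∀ q, 0 < q → q < p → ∃ k, k + q < p ∧ g (c + k) ≠ g (c + k + q) := by
  have hperm : ∀ n k, g (k + p * n) = g k := by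
    intro n
    induction n with
    | zero => simp
    | succ n ih => intro k; rw [Nat.mul_succ, ← add_assoc, hper, ih]
  let G : ℕ → Lex (ℕ → β) := fun c => toLex (fun k => g (c + k))
  obtain ⟨c, hc, hcmin⟩ := Finset.exists_min_image (Finset.range p) G ⟨0, by simpa using hp⟩
  have hGmod : ∀ d, G d = G (d % p) := by
    intro d
    apply congrArg toLex
    funext k
    conv_lhs => rw [← Nat.mod_add_div d p]
    rw [← hperm (d / p) (d % p + k)]
    congr 1
    ring
  have hall : ∀ d, G c ≤ G d := by
    intro d
    rw [hGmod d]
    exact hcmin _ (by simpa using Nat.mod_lt _ hp)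
  refine ⟨c, by simpa using hc, ?_⟩
  intro q hq hqp
  by_contra hcon
  push Not at hcon
  have h1 := lex_drop (fun k => g (c + k)) (fun k => g (c + q + k)) (p - q)
    (by
      intro k hk
      have := hcon k (by omega)
      show g (c + k) = g (c + q + k)
      rw [this]
      congr 1
      ring) (hall (c + q))
  have h2 : G (c + (p - q)) ≤ G c := by
    refine le_trans (le_of_eq ?_) (le_trans h1 (le_of_eq ?_))
    · apply congrArg toLex
      funext k
      congr 1
      ring
    · apply congrArg toLex
      funext k
      rw [← hper (c + k)]
      congr 1
      omega
  have h3 : G (c + (p - q)) = G c := le_antisymm h2 (hall _)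
  obtain ⟨k, hk⟩ := hmin (p - q) (by omega) (by omega)
  apply hk
  have h4 := congrFun (congrArg ofLex h3) (k + p * c - c)
  have hle : c ≤ p * c := Nat.le_mul_of_pos_left c hp
  simp only [G, ofLex_toLex] at h4
  rw [← hperm c (k + (p - q)), ← hperm c k]
  convert h4 using 2 <;> omega

/-- `s` is the centre of a square of period `p` with unbordered root. -/
def Centre (u : List α) (s p : ℕ) : Prop :=
  p ≤ s ∧ 0 < p ∧ (∀ k, k < p → u[s - p + k]? = u[s + k]?) ∧
    ∀ q, 0 < q → q < p → ∃ k, k + q < p ∧ u[s + k]? ≠ u[s + k + q]?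

theorem Centre.not_lt {u : List α} {s p p' : ℕ} (h : Centre u s p) (h' : Centre u s p') :
    ¬ p < p' := by
  intro hlt
  obtain ⟨a1, a2, a3, a4⟩ := h
  obtain ⟨b1, b2, b3, b4⟩ := h'
  obtain ⟨k, hk, hne⟩ := b4 (p' - p) (by omega) (by omega)
  apply hne
  rw [← a3 k (by omega), add_assoc, ← b3 (k + (p' - p)) (by omega)]
  congr 1
  omega

theorem factor_get (u : List α) (i j k : ℕ) (hk : k < j - i + 1) :
    (factor u i j)[k]? = u[i + k]? := by
  simp [factor, hk]

theorem factor_length (u : List α) (i j : ℕ) (h : i ≤ j) (hj : j < u.length) :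
    (factor u i j).length = j - i + 1 := by
  simp [factor]; omega

theorem minPeriod_spec (u : List α) (i j : ℕ) (h : i ≤ j) (hj : j < u.length) :
    0 < minPeriod (factor u i j) ∧
    (∀ k, i ≤ k → k + minPeriod (factor u i j) ≤ j →
      u[k]? = u[k + minPeriod (factor u i j)]?) ∧
    ∀ q, 0 < q → q < minPeriod (factor u i j) →
      ∃ k, i ≤ k ∧ k + q ≤ j ∧ u[k]? ≠ u[k + q]? := by
  have hl := factor_length u i j h hj
  have hmem : minPeriod (factor u i j) ∈ {p | IsPeriod (factor u i j) p} := by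
    apply Nat.sInf_mem
    exact ⟨(factor u i j).length, by omega, fun k hk => by omega⟩
  refine ⟨hmem.1, ?_, ?_⟩
  · intro k hik hkj
    have := hmem.2 (k - i) (by omega)
    rw [factor_get _ _ _ _ (by omega), factor_get _ _ _ _ (by omega)] at this
    convert this using 2 <;> omega
  · intro q hq hqp
    by_contra hcon
    push Not at hcon
    apply Nat.notMem_of_lt_sInf hqp
    refine ⟨hq, fun k hk => ?_⟩
    rw [factor_get _ _ _ _ (by omega), factor_get _ _ _ _ (by omega), ← add_assoc]
    exact hcon (i + k) (by omega) (by omega)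

/-- The unbordered square centres lying in the run `[i..j]`. -/
noncomputable def centres (u : List α) (q : ℕ × ℕ) : Finset ℕ :=
  (Finset.Icc (q.1 + minPeriod (factor u q.1 q.2)) (q.2 + 1 - minPeriod (factor u q.1 q.2))).filter
    fun s => Centre u s (minPeriod (factor u q.1 q.2))

theorem card_centres [LinearOrder α] (u : List α) (i j : ℕ) (h : IsRun u i j) :
    (j - i + 1) / minPeriod (factor u i j) ≤ (centres u (i, j)).card + 2 := by
  obtain ⟨hij, hj, h2, -, -⟩ := h
  obtain ⟨hp, hper, hmin⟩ := minPeriod_spec u i j hij hj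
  unfold centres
  dsimp only
  generalize minPeriod (factor u i j) = p at *
  have hmod : ∀ k, i ≤ k → k ≤ j → u[k]? = u[i + (k - i) % p]? := by
    intro k
    induction k using Nat.strong_induction_on with
    | _ k ih =>
      intro hik hkj
      rcases lt_or_ge (k - i) p with hlt | hge
      · rw [Nat.mod_eq_of_lt hlt]; congr 1; omega
      · have e1 := hper (k - p) (by omega) (by omega)
        have e2 := ih (k - p) (by omega) (by omega) (by omega)
        rw [show k - p + p = k by omega] at e1
        rw [← e1, e2, Nat.mod_eq_sub_mod hge]
        congr 3
        omega
  let g : ℕ → WithBot α := fun k => (u[i + k % p]? : Option α)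
  have hg : ∀ k, i ≤ k → k ≤ j → g (k - i) = (u[k]? : Option α) := fun k h1 h2 => (hmod k h1 h2).symm
  obtain ⟨c, hcp, hc⟩ := exists_unbordered g p hp
    (fun k => by
      show g (k + p) = g k
      simp only [g]
      rw [Nat.add_mod_right])
    (by
      intro q hq hqp
      obtain ⟨k, h1, h2, h3⟩ := hmin q hq hqp
      refine ⟨k - i, ?_⟩
      intro he
      apply h3
      have e1 := hg k h1 (by omega)
      have e2 := hg (k + q) (by omega) h2
      rw [show k + q - i = k - i + q by omega] at e2
      exact e1.symm.trans (he.symm.trans e2))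
  have hsub : (Finset.range ((j - i + 1) / p - 2)).image (fun t => i + c + p * (t + 1)) ⊆
      (Finset.Icc (i + p) (j + 1 - p)).filter fun s => Centre u s p := by
    intro s hs
    simp only [Finset.mem_image, Finset.mem_range] at hs
    obtain ⟨t, ht, rfl⟩ := hs
    have b1 : p * (t + 3) ≤ j - i + 1 :=
      le_trans (Nat.mul_le_mul_left p (by omega)) (Nat.mul_div_le _ _)
    have b2 : p * (t + 3) = p * (t + 1) + 2 * p := by ring
    have b3 : p * (t + 1) = p * t + p := by ring
    simp only [Finset.mem_filter, Finset.mem_Icc]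
    refine ⟨⟨by omega, by omega⟩, by omega, hp, ?_, ?_⟩
    · intro k hk
      have := hper (i + c + p * (t + 1) - p + k) (by omega) (by omega)
      rw [this]
      congr 1
      omega
    · intro q hq hqp
      obtain ⟨k, hk, hne⟩ := hc q hq hqp
      refine ⟨k, hk, ?_⟩
      intro he
      apply hne
      have key : ∀ l, l < p → g (c + l) = (u[i + c + p * (t + 1) + l]? : Option α) := by
        intro l hl
        rw [← hg _ (by omega) (by omega)]
        simp only [g]
        rw [show i + c + p * (t + 1) + l - i = c + l + p * (t + 1) by omega,
          Nat.add_mul_mod_self_left]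
      have k2 := key (k + q) hk
      rw [← add_assoc, ← add_assoc] at k2
      exact (key k (by omega)).trans (Eq.trans he k2.symm)
  have hcard := Finset.card_le_card hsub
  rw [Finset.card_image_of_injective, Finset.card_range] at hcard
  · omega
  · intro a b hab
    have := Nat.eq_of_mul_eq_mul_left hp (Nat.add_left_cancel hab)
    omega

theorem run_eq {u : List α} {i j i' j' s : ℕ} (h : IsRun u i j) (h' : IsRun u i' j')
    (hs : s ∈ centres u (i, j)) (hs' : s ∈ centres u (i', j')) : i' ≤ i ∧ j ≤ j' := by
  obtain ⟨hij, hj, -, hL, hR⟩ := h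
  obtain ⟨hij', hj', -, hL', hR'⟩ := h'
  obtain ⟨hp, hper, -⟩ := minPeriod_spec u i j hij hj
  unfold centres at hs hs'
  simp only [Finset.mem_filter, Finset.mem_Icc] at hs hs'
  have e : minPeriod (factor u i' j') = minPeriod (factor u i j) :=
    le_antisymm (not_lt.mp (hs.2.not_lt hs'.2)) (not_lt.mp (hs'.2.not_lt hs.2))
  rw [e] at hs' hL' hR'
  generalize minPeriod (factor u i j) = p at *
  constructor
  · by_contra hlt
    rcases hL' with h0 | h0
    · omega
    · apply h0
      rw [hper (i' - 1) (by omega) (by omega)]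
      congr 1
      omega
  · by_contra hlt
    rcases hR' with h0 | h0
    · omega
    · apply h0
      rw [hper (j' - p + 1) (by omega) (by omega)]
      congr 1
      omega

/-- For any word `u` of length `n ≥ 1`, `σ(u) < 3 ρ(u) + n`. -/
theorem sigma_lt_three_rho_add_length [LinearOrder α] (u : List α)
    (hn : 1 ≤ u.length) :
    sigma u < 3 * ((runs u).card : ℚ) + (u.length : ℚ) := by
  have hrun : ∀ q ∈ runs u, IsRun u q.1 q.2 := fun q hq => (Finset.mem_filter.mp hq).2
  have hexp : ∀ q ∈ runs u, exponent u q.1 q.2 ≤ 3 + ((centres u q).card : ℚ) := by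
    rintro ⟨i, j⟩ hq
    have h := hrun _ hq
    have hc := card_centres u i j h
    obtain ⟨hp, -, -⟩ := minPeriod_spec u i j h.1 h.2.1
    have hij : i ≤ j := h.1
    unfold exponent
    dsimp only
    rw [div_le_iff₀ (by exact_mod_cast hp)]
    have h1 : j - i + 1 ≤ (3 + (centres u (i, j)).card) * minPeriod (factor u i j) := by
      have h2 := Nat.lt_mul_div_succ (j - i + 1) hp
      refine le_trans h2.le ?_
      rw [mul_comm]
      exact Nat.mul_le_mul_right _ (by omega)
    have h3 : ((j - i + 1 : ℕ) : ℚ) ≤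
        (((3 + (centres u (i, j)).card) * minPeriod (factor u i j) : ℕ) : ℚ) := by
      exact_mod_cast h1
    push_cast [Nat.cast_sub hij] at h3
    exact h3
  have hdisj : (↑(runs u) : Set (ℕ × ℕ)).PairwiseDisjoint (centres u) := by
    rintro ⟨i, j⟩ hq ⟨i', j'⟩ hq' hne
    refine Finset.disjoint_left.mpr fun s hs hs' => hne ?_
    have a := run_eq (hrun _ hq) (hrun _ hq') hs hs'
    have b := run_eq (hrun _ hq') (hrun _ hq) hs' hs
    ext <;> simp only <;> omega
  have hsum : ∑ q ∈ runs u, (centres u q).card ≤ u.length - 1 := by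
    rw [← Finset.card_biUnion hdisj]
    have : (runs u).biUnion (centres u) ⊆ Finset.Icc 1 (u.length - 1) := by
      intro s hs
      obtain ⟨⟨i, j⟩, hq, hs⟩ := Finset.mem_biUnion.mp hs
      have h := hrun _ hq
      obtain ⟨hp, -, -⟩ := minPeriod_spec u i j h.1 h.2.1
      have hj : j < u.length := h.2.1
      unfold centres at hs
      simp only [Finset.mem_filter, Finset.mem_Icc] at hs ⊢
      omega
    simpa using Finset.card_le_card this
  have h1 : sigma u ≤ ∑ q ∈ runs u, (3 + ((centres u q).card : ℚ)) := Finset.sum_le_sum hexp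
  rw [Finset.sum_add_distrib, Finset.sum_const, nsmul_eq_mul] at h1
  have h2 : ∑ q ∈ runs u, ((centres u q).card : ℚ) < (u.length : ℚ) := by
    have : ∑ q ∈ runs u, (centres u q).card < u.length := by omega
    exact_mod_cast this
  linarith
end RunsExp
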